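/- Let l : 2^V → ℝ be a set function with l(∅) = 0. Then l is submodular if and only if its Lovász extension ℓ̂ is a convex function on ℝ^p. -/

import Mathlib

open Finset

/-- The chain {σ₁,…,σⱼ}: the image under σ of the first j indices. -/
def chainSet {p : ℕ} (σ : Equiv.Perm (Fin p)) (j : ℕ) : Finset (Fin p) :=
  (Finset.univ.filter fun k : Fin p => (k : ℕ) < j).image σ

/-- G_l(σ, s) = Σ_{j=1}^p s_{σ_j}·(l({σ₁,…,σⱼ}) − l({σ₁,…,σ_{j−1}})). -/
def lovaszSum {p : ℕ} (l : Finset (Fin p) → ℝ) (σ : Equiv.Perm (Fin p))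
    (s : Fin p → ℝ) : ℝ :=
  ∑ j : Fin p, s (σ j) * (l (chainSet σ ((j : ℕ) + 1)) - l (chainSet σ (j : ℕ)))

/-- Indicator vector 1_A ∈ {0,1}^p of A ⊆ V. -/
def indic {p : ℕ} (A : Finset (Fin p)) : Fin p → ℝ := fun i => if i ∈ A then 1 else 0

/-- A permutation sorting s in decreasing order: s_{π_1} ≥ … ≥ s_{π_p}. -/
def SortsDesc {p : ℕ} (π : Equiv.Perm (Fin p)) (s : Fin p → ℝ) : Prop :=
  ∀ j k : Fin p, j ≤ k → s (π k) ≤ s (π j)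

/-- A canonical permutation sorting s in decreasing order. -/
noncomputable def sortDesc {p : ℕ} (s : Fin p → ℝ) : Equiv.Perm (Fin p) :=
  Tuple.sort (fun i => -s i)

/-- The Lovász extension ℓ̂(s) = G_l(π, s) for a permutation π sorting s
decreasingly (independent of the choice of such π). -/
noncomputable def lovaszExt {p : ℕ} (l : Finset (Fin p) → ℝ) (s : Fin p → ℝ) : ℝ :=
  lovaszSum l (sortDesc s) s

/-- Submodularity: l(A) + l(B) ≥ l(A ∪ B) + l(A ∩ B). -/
def Submodular {p : ℕ} (l : Finset (Fin p) → ℝ) : Prop :=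
  ∀ A B : Finset (Fin p), l (A ∪ B) + l (A ∩ B) ≤ l A + l B

/-- The slack-rescaling surrogate S_l(s) = max_{I⊆V} l(I)·(1 − 2 Σ_{i∈I}(1 − s_i)). -/
noncomputable def slackSur {p : ℕ} (l : Finset (Fin p) → ℝ) (s : Fin p → ℝ) : ℝ :=
  Finset.univ.sup' Finset.univ_nonempty
    (fun I : Finset (Fin p) => l I * (1 - 2 * ∑ i ∈ I, (1 - s i)))

/-- The margin-rescaling surrogate M_l(s) = max_{I⊆V} ( l(I) − 2 Σ_{i∈I}(1 − s_i) ). -/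
noncomputable def marginSur {p : ℕ} (l : Finset (Fin p) → ℝ) (s : Fin p → ℝ) : ℝ :=
  Finset.univ.sup' Finset.univ_nonempty
    (fun I : Finset (Fin p) => l I - 2 * ∑ i ∈ I, (1 - s i))

/-- The Lovász hinge, general (non-monotonic) case. -/
noncomputable def hingeGen {p : ℕ} (l : Finset (Fin p) → ℝ) (s : Fin p → ℝ) : ℝ :=
  Finset.univ.sup' Finset.univ_nonempty
    (fun σ : Equiv.Perm (Fin p) => max 0 (lovaszSum l σ s))

/-- The Lovász hinge, increasing case (componentwise thresholding). -/
noncomputable def hingeInc {p : ℕ} (l : Finset (Fin p) → ℝ) (s : Fin p → ℝ) : ℝ :=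
  Finset.univ.sup' Finset.univ_nonempty
    (fun σ : Equiv.Perm (Fin p) =>
      ∑ j : Fin p, max (s (σ j)) 0 *
        (l (chainSet σ ((j : ℕ) + 1)) - l (chainSet σ (j : ℕ))))

theorem mem_chainSet {p : ℕ} (σ : Equiv.Perm (Fin p)) (n : ℕ) (i : Fin p) :
    i ∈ chainSet σ n ↔ (σ.symm i : ℕ) < n := by
  simp only [chainSet, mem_image, mem_filter, mem_univ, true_and]
  constructor
  · rintro ⟨k, hk, rfl⟩
    simpa using hk
  · exact fun h => ⟨σ.symm i, h, by simp⟩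

theorem chainSet_zero {p : ℕ} (σ : Equiv.Perm (Fin p)) : chainSet σ 0 = ∅ := by
  ext i
  simp [mem_chainSet]

theorem chainSet_eq_univ {p : ℕ} (σ : Equiv.Perm (Fin p)) : chainSet σ p = univ := by
  ext i
  simp [mem_chainSet]

theorem chainSet_succ {p : ℕ} (σ : Equiv.Perm (Fin p)) (n : Fin p) :
    chainSet σ (n + 1) = insert (σ n) (chainSet σ n) := by
  ext i
  rw [mem_insert, mem_chainSet, mem_chainSet, ← Equiv.symm_apply_eq, Fin.ext_iff]
  omega

theorem apply_notMem_chainSet {p : ℕ} (σ : Equiv.Perm (Fin p)) (n : Fin p) :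
    σ n ∉ chainSet σ n := by
  simp [mem_chainSet]

/-- Induction along the chain of a permutation. -/
theorem chainSet_induction {p : ℕ} (σ : Equiv.Perm (Fin p)) {P : Finset (Fin p) → Prop}
    (empty : P ∅)
    (insert : ∀ n : Fin p, P (chainSet σ n) → P (insert (σ n) (chainSet σ n)))
    {n : ℕ} (hn : n ≤ p) : P (chainSet σ n) := by
  induction n with
  | zero => rwa [chainSet_zero]
  | succ n ih =>
    have h := insert ⟨n, hn⟩ (ih (by omega))
    rwa [← chainSet_succ] at h

/-- The marginal gain of each element along the chain of `σ`. -/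
def chainGain {p : ℕ} (l : Finset (Fin p) → ℝ) (σ : Equiv.Perm (Fin p)) (i : Fin p) : ℝ :=
  l (chainSet σ ((σ.symm i : ℕ) + 1)) - l (chainSet σ (σ.symm i : ℕ))

theorem chainGain_apply {p : ℕ} (l : Finset (Fin p) → ℝ) (σ : Equiv.Perm (Fin p)) (n : Fin p) :
    chainGain l σ (σ n) = l (insert (σ n) (chainSet σ n)) - l (chainSet σ n) := by
  simp [chainGain, chainSet_succ]

theorem lovaszSum_eq_sum_chainGain {p : ℕ} (l : Finset (Fin p) → ℝ) (σ : Equiv.Perm (Fin p))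
    (s : Fin p → ℝ) : lovaszSum l σ s = ∑ i, s i * chainGain l σ i := by
  rw [← Equiv.sum_comp σ]
  simp [lovaszSum, chainGain]

theorem sum_chainGain_chainSet {p : ℕ} {l : Finset (Fin p) → ℝ} (h0 : l ∅ = 0)
    (σ : Equiv.Perm (Fin p)) {n : ℕ} (hn : n ≤ p) :
    ∑ i ∈ chainSet σ n, chainGain l σ i = l (chainSet σ n) := by
  refine chainSet_induction σ (P := fun C => ∑ i ∈ C, chainGain l σ i = l C)
    (by simp [h0]) (fun n ih => ?_) hn
  rw [sum_insert (apply_notMem_chainSet σ n), ih, chainGain_apply]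
  ring

theorem Submodular.sum_chainGain_le {p : ℕ} {l : Finset (Fin p) → ℝ} (hl : Submodular l)
    (h0 : l ∅ = 0) (σ : Equiv.Perm (Fin p)) (A : Finset (Fin p)) :
    ∑ i ∈ A, chainGain l σ i ≤ l A := by
  have key := chainSet_induction σ
    (P := fun C => ∑ i ∈ A ∩ C, chainGain l σ i ≤ l (A ∩ C)) (by simp [h0]) (fun n ih => ?_)
    le_rfl
  · simpa [chainSet_eq_univ] using key
  by_cases hA : σ n ∈ A
  · have hn := apply_notMem_chainSet σ n
    have hsub := hl (insert (σ n) (A ∩ chainSet σ n)) (chainSet σ n)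
    have hunion : insert (σ n) (A ∩ chainSet σ n) ∪ chainSet σ n =
        insert (σ n) (chainSet σ n) := by
      rw [insert_union, union_eq_right.2 inter_subset_right]
    have hinter : insert (σ n) (A ∩ chainSet σ n) ∩ chainSet σ n = A ∩ chainSet σ n := by
      rw [insert_inter_of_notMem hn, inter_assoc, inter_self]
    rw [hunion, hinter] at hsub
    rw [inter_insert_of_mem hA, sum_insert (by simp [hn]), chainGain_apply]
    linarith
  · rwa [inter_insert_of_notMem hA]

/-- Abel summation along the chain of a sorting permutation. -/
theorem SortsDesc.sum_mul_nonneg {p : ℕ} {π : Equiv.Perm (Fin p)} {s : Fin p → ℝ}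
    (hπ : SortsDesc π s) {d : Fin p → ℝ} (hd : ∀ n ≤ p, 0 ≤ ∑ i ∈ chainSet π n, d i)
    (htot : ∑ i, d i = 0) : 0 ≤ ∑ i, s i * d i := by
  have key : ∀ n ≤ p, ∀ c, (∀ i ∈ chainSet π n, c ≤ s i) →
      c * ∑ i ∈ chainSet π n, d i ≤ ∑ i ∈ chainSet π n, s i * d i := by
    intro n
    induction n with
    | zero => simp [chainSet_zero]
    | succ n ih =>
      intro hn c hc
      have hD := hd (n + 1) hn
      have hlast := ih (by omega) (s (π ⟨n, hn⟩)) fun i hi => by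
        simpa using hπ (π.symm i) ⟨n, hn⟩ ((mem_chainSet π n i).1 hi).le
      have hsucc := chainSet_succ π ⟨n, hn⟩
      have hnot := apply_notMem_chainSet π ⟨n, hn⟩
      simp only at hsucc hnot
      have hcn := hc (π ⟨n, hn⟩) (by simp [hsucc])
      rw [hsucc, sum_insert hnot] at hD ⊢
      rw [sum_insert hnot]
      nlinarith [mul_le_mul_of_nonneg_right hcn hD]
  obtain ⟨c, hc⟩ := (Set.finite_range s).bddBelow
  have h := key p le_rfl c fun i _ => hc ⟨i, rfl⟩
  simpa [chainSet_eq_univ, htot] using h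

theorem sortsDesc_sortDesc {p : ℕ} (s : Fin p → ℝ) : SortsDesc (sortDesc s) s := by
  intro j k hjk
  simpa [sortDesc] using Tuple.monotone_sort (fun i => -s i) hjk

theorem Submodular.lovaszSum_le_lovaszExt {p : ℕ} {l : Finset (Fin p) → ℝ} (hl : Submodular l)
    (h0 : l ∅ = 0) (σ : Equiv.Perm (Fin p)) (s : Fin p → ℝ) :
    lovaszSum l σ s ≤ lovaszExt l s := by
  rw [lovaszExt, lovaszSum_eq_sum_chainGain, lovaszSum_eq_sum_chainGain, ← sub_nonneg,
    ← sum_sub_distrib]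
  simp_rw [← mul_sub]
  refine (sortsDesc_sortDesc s).sum_mul_nonneg (fun n hn => ?_) ?_
  · rw [sum_sub_distrib, sum_chainGain_chainSet h0 _ hn, sub_nonneg]
    exact hl.sum_chainGain_le h0 σ _
  · have h (τ : Equiv.Perm (Fin p)) : ∑ i, chainGain l τ i = l univ := by
      simpa [chainSet_eq_univ] using sum_chainGain_chainSet h0 τ le_rfl
    rw [sum_sub_distrib, h, h, sub_self]

/-- Strict superlevel sets belong to the chain of a sorting permutation. -/
theorem SortsDesc.exists_eq_chainSet {p : ℕ} {π : Equiv.Perm (Fin p)} {s : Fin p → ℝ}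
    (hπ : SortsDesc π s) {U : Finset (Fin p)} (hU : ∀ i ∈ U, ∀ j ∉ U, s j < s i) :
    ∃ n ≤ p, U = chainSet π n := by
  classical
  have hex : ∃ n, ∀ h : n < p, π ⟨n, h⟩ ∉ U := ⟨p, fun h => absurd h (lt_irrefl p)⟩
  refine ⟨Nat.find hex, Nat.find_min' hex fun h => absurd h (lt_irrefl p), ?_⟩
  ext i
  rw [mem_chainSet]
  constructor
  · intro hi
    by_contra! hlt
    have hn := hlt.trans_lt (π.symm i).isLt
    have h := hπ ⟨Nat.find hex, hn⟩ (π.symm i) hlt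
    rw [Equiv.apply_symm_apply] at h
    exact (hU i hi _ (Nat.find_spec hex hn)).not_ge h
  · intro hlt
    simpa using Nat.find_min hex hlt

theorem sum_chainGain_sortDesc {p : ℕ} {l : Finset (Fin p) → ℝ} (h0 : l ∅ = 0)
    {s : Fin p → ℝ} {U : Finset (Fin p)} (hU : ∀ i ∈ U, ∀ j ∉ U, s j < s i) :
    ∑ i ∈ U, chainGain l (sortDesc s) i = l U := by
  obtain ⟨n, hn, rfl⟩ := (sortsDesc_sortDesc s).exists_eq_chainSet hU
  exact sum_chainGain_chainSet h0 _ hn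

theorem sum_indic_mul {p : ℕ} (A : Finset (Fin p)) (f : Fin p → ℝ) :
    ∑ i, indic A i * f i = ∑ i ∈ A, f i := by
  simp [indic]

theorem lovaszExt_indic {p : ℕ} {l : Finset (Fin p) → ℝ} (h0 : l ∅ = 0) (A : Finset (Fin p)) :
    lovaszExt l (indic A) = l A := by
  rw [lovaszExt, lovaszSum_eq_sum_chainGain, sum_indic_mul]
  refine sum_chainGain_sortDesc h0 fun i hi j hj => ?_
  simp [indic, hi, hj]

theorem lovaszExt_midpoint_indic {p : ℕ} {l : Finset (Fin p) → ℝ} (h0 : l ∅ = 0)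
    (A B : Finset (Fin p)) :
    lovaszExt l ((1 / 2 : ℝ) • indic A + (1 / 2 : ℝ) • indic B) =
      (l (A ∪ B) + l (A ∩ B)) / 2 := by
  set s := (1 / 2 : ℝ) • indic A + (1 / 2 : ℝ) • indic B with hs
  have hsplit (i : Fin p) : s i * chainGain l (sortDesc s) i =
      (indic (A ∪ B) i * chainGain l (sortDesc s) i +
        indic (A ∩ B) i * chainGain l (sortDesc s) i) / 2 := by
    have : s i = (indic (A ∪ B) i + indic (A ∩ B) i) / 2 := by
      by_cases hA : i ∈ A <;> by_cases hB : i ∈ B <;> norm_num [hs, indic, hA, hB]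
    rw [this]
    ring
  rw [lovaszExt, lovaszSum_eq_sum_chainGain, sum_congr rfl fun i _ => hsplit i, ← sum_div,
    sum_add_distrib, sum_indic_mul, sum_indic_mul, sum_chainGain_sortDesc h0,
    sum_chainGain_sortDesc h0]
  all_goals
    intro i hi j hj
    by_cases hA : i ∈ A <;> by_cases hB : i ∈ B <;> by_cases hA' : j ∈ A <;>
      by_cases hB' : j ∈ B <;> simp_all [indic]

/-- l is submodular iff its Lovász extension is convex on ℝ^p. -/
theorem submodular_iff_lovasz_convex (p : ℕ) (hp : 1 ≤ p)
    (l : Finset (Fin p) → ℝ) (h0 : l ∅ = 0) :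
    Submodular l ↔ ConvexOn ℝ Set.univ (lovaszExt l) := by
  constructor
  · refine fun hl => ⟨convex_univ, fun x _ y _ a b ha hb _ => ?_⟩
    have hlin (σ : Equiv.Perm (Fin p)) :
        lovaszSum l σ (a • x + b • y) = a * lovaszSum l σ x + b * lovaszSum l σ y := by
      simp only [lovaszSum, mul_sum, ← sum_add_distrib, Pi.add_apply, Pi.smul_apply, smul_eq_mul]
      exact sum_congr rfl fun i _ => by ring
    rw [lovaszExt, hlin, smul_eq_mul, smul_eq_mul]
    gcongr <;> exact hl.lovaszSum_le_lovaszExt h0 _ _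
  · intro hconv A B
    have h := hconv.2 (Set.mem_univ (indic A)) (Set.mem_univ (indic B))
      (by norm_num : (0 : ℝ) ≤ 1 / 2) (by norm_num : (0 : ℝ) ≤ 1 / 2) (by norm_num)
    rw [lovaszExt_midpoint_indic h0, lovaszExt_indic h0, lovaszExt_indic h0, smul_eq_mul,
      smul_eq_mul] at h
    linarith
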